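/- Suppose real numbers μ, a_1, …, a_14 are such that the 8 × 8 symmetric matrix G(μ, a_1, …, a_14) has rank at most 3, 0.6 ≤ μ ≤ 0.64759, and |a_j| < μ for all 1 ≤ j ≤ 14. Then a_2 = (−3μ − 2μ² + 9μ³)/(1 + 2μ + μ²). -/

import Mathlib

/-- The `8 × 8` symmetric matrix `G(μ, a₁, …, a₁₄)` from the paper. -/
def packingGram (μ a1 a2 a3 a4 a5 a6 a7 a8 a9 a10 a11 a12 a13 a14 : ℝ) :
    Matrix (Fin 8) (Fin 8) ℝ :=
  !![1,  a1,  μ,  a2,  a3, -μ,  a4, -μ;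
     a1, 1,  -μ,  a5, -μ,  a6, -μ,  a7;
     μ, -μ,   1,   μ,  a8, -μ,  a9, a10;
     a2, a5,  μ,   1, a11, a12,  μ,   μ;
     a3, -μ, a8, a11,   1,   μ,  μ,  -μ;
     -μ, a6, -μ, a12,   μ,   1,  μ, a13;
     a4, -μ, a9,   μ,   μ,   μ,  1, a14;
     -μ, a7, a10,  μ,  -μ, a13, a14,  1]

/-- All `4 × 4` minors of a matrix of rank at most 3 vanish. -/
theorem minor_zero (M : Matrix (Fin 8) (Fin 8) ℝ) (h : M.rank ≤ 3) (r c : Fin 4 → Fin 8) :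
    (M.submatrix r c).det = 0 := by
  by_contra hd
  have hu : IsUnit (M.submatrix r c) := by
    rw [Matrix.isUnit_iff_isUnit_det]
    exact isUnit_iff_ne_zero.mpr hd
  have h4 := Matrix.rank_of_isUnit _ hu
  have hle : (M.submatrix r c).rank ≤ M.rank := Matrix.rank_submatrix_le M r c
  simp at h4
  omega

/-- Explicit expansion of a `4 × 4` determinant. -/
theorem det_four (A : Matrix (Fin 4) (Fin 4) ℝ) : A.det =
    A 0 0 * (A 1 1 * (A 2 2 * A 3 3 - A 2 3 * A 3 2) - A 1 2 * (A 2 1 * A 3 3 - A 2 3 * A 3 1)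
      + A 1 3 * (A 2 1 * A 3 2 - A 2 2 * A 3 1))
    - A 0 1 * (A 1 0 * (A 2 2 * A 3 3 - A 2 3 * A 3 2) - A 1 2 * (A 2 0 * A 3 3 - A 2 3 * A 3 0)
      + A 1 3 * (A 2 0 * A 3 2 - A 2 2 * A 3 0))
    + A 0 2 * (A 1 0 * (A 2 1 * A 3 3 - A 2 3 * A 3 1) - A 1 1 * (A 2 0 * A 3 3 - A 2 3 * A 3 0)
      + A 1 3 * (A 2 0 * A 3 1 - A 2 1 * A 3 0))
    - A 0 3 * (A 1 0 * (A 2 1 * A 3 2 - A 2 2 * A 3 1) - A 1 1 * (A 2 0 * A 3 2 - A 2 2 * A 3 0)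
      + A 1 2 * (A 2 0 * A 3 1 - A 2 1 * A 3 0)) := by
  simp [Matrix.det_succ_row_zero, Fin.sum_univ_succ, Fin.succAbove]
  ring

/-- **Step 9.** Under the rank-3 and coherence conditions on `G`, the coefficient `a₂` is determined. -/
theorem step9
    (μ a1 a2 a3 a4 a5 a6 a7 a8 a9 a10 a11 a12 a13 a14 : ℝ)
    (hrank : (packingGram μ a1 a2 a3 a4 a5 a6 a7 a8 a9 a10 a11 a12 a13 a14).rank ≤ 3)
    (hμ1 : (0.6 : ℝ) ≤ μ) (hμ2 : μ ≤ 0.64759)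
    (h1 : |a1| < μ) (h2 : |a2| < μ) (h3 : |a3| < μ) (h4 : |a4| < μ) (h5 : |a5| < μ)
    (h6 : |a6| < μ) (h7 : |a7| < μ) (h8 : |a8| < μ) (h9 : |a9| < μ) (h10 : |a10| < μ)
    (h11 : |a11| < μ) (h12 : |a12| < μ) (h13 : |a13| < μ) (h14 : |a14| < μ) :
    a2 = (-3 * μ - 2 * μ ^ 2 + 9 * μ ^ 3) / (1 + 2 * μ + μ ^ 2) := by
  have key := minor_zero _ hrank
  rw [abs_lt] at h2 h5 h6 h9
  have hμ0 : 0 < μ := by linarith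
  have hp : (0 : ℝ) < 1 + μ := by linarith
  have hq : (0 : ℝ) < 1 - μ := by linarith
  have hw : (0 : ℝ) < 1 + 2 * μ := by linarith
  have m1 := key ![1, 4, 5, 6] ![1, 4, 5, 6]
  have m2 := key ![1, 4, 5, 6] ![2, 4, 5, 6]
  have m3 := key ![2, 4, 5, 6] ![2, 4, 5, 6]
  have m4 := key ![1, 2, 3, 6] ![1, 2, 3, 6]
  have m5 := key ![1, 2, 3, 6] ![1, 2, 5, 6]
  have m6 := key ![0, 2, 3, 5] ![0, 2, 3, 5]
  rw [det_four] at m1 m2 m3 m4 m5 m6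
  simp [packingGram] at m1 m2 m3 m4 m5 m6
  have a6eq : a6 = (1 + μ - 4 * μ ^ 2) / (1 + μ) := by
    have e : (1 - μ) * (1 + a6) * ((1 + μ) * (1 - a6) - 4 * μ ^ 2) = 0 := by
      linear_combination m1
    have n1 : (1 - μ) * (1 + a6) ≠ 0 := mul_ne_zero hq.ne' (by linarith [h6.1])
    have e2 := (mul_eq_zero.mp e).resolve_left n1
    rw [eq_div_iff hp.ne']
    linear_combination -e2
  have a8eq : a8 = -a9 := by
    rw [a6eq] at m2
    field_simp at m2
    have n1 : 2 * μ * (1 - μ) ^ 2 * (1 + 2 * μ) ≠ 0 := by positivity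
    have e : (2 * μ * (1 - μ) ^ 2 * (1 + 2 * μ)) * (a8 + a9) = 0 := by
      first
        | linear_combination m2
        | (have h0 : (0 : ℝ) < μ := by linarith
           apply mul_left_cancel₀ h0.ne'
           linear_combination m2)
    linarith [(mul_eq_zero.mp e).resolve_left n1]
  have a9sq : 2 * (1 + 2 * μ) * a9 ^ 2 = 1 + μ - 3 * μ ^ 2 - μ ^ 3 := by
    rw [a8eq] at m3
    apply mul_left_cancel₀ hq.ne'
    linear_combination -m3
  have hn9 : (0 : ℝ) < 1 - a9 := by linarith [h9.2]
  have hp9 : (0 : ℝ) < 1 + a9 := by linarith [h9.1]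
  have a5eq : (1 + a9) * (1 - a5) = 4 * μ ^ 2 := by
    have e : (1 - a9) * (1 + a5) * ((1 + a9) * (1 - a5) - 4 * μ ^ 2) = 0 := by
      linear_combination m4
    have n1 : (1 - a9) * (1 + a5) ≠ 0 := mul_ne_zero hn9.ne' (by linarith [h5.1])
    linarith [(mul_eq_zero.mp e).resolve_left n1]
  have nd : 1 + a9 - 2 * μ ^ 2 ≠ 0 := by
    intro h
    have e : (1 + a9) * (1 + a5) = 0 := by linear_combination 2 * h - a5eq
    have := (mul_eq_zero.mp e).resolve_left hp9.ne'
    linarith [h5.1]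
  have a12eq : a12 = a6 := by
    have a5' : a5 = 1 - 4 * μ ^ 2 / (1 + a9) := by
      field_simp
      linear_combination -a5eq
    rw [a5'] at m5
    field_simp at m5
    have e : ((1 - a9) * (1 + a9 - 2 * μ ^ 2)) * (a12 - a6) = 0 := by
      apply mul_left_cancel₀ hp9.ne'
      linear_combination m5
    linarith [(mul_eq_zero.mp e).resolve_left (mul_ne_zero hn9.ne' nd)]
  rw [a12eq, a6eq] at m6
  field_simp at m6
  have e : ((1 - μ) * (a2 - μ)) *
      ((1 + μ) ^ 2 * a2 - (-3 * μ - 2 * μ ^ 2 + 9 * μ ^ 3)) = 0 := by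
    apply mul_left_cancel₀ hp.ne'
    linear_combination -m6
  have e2 := (mul_eq_zero.mp e).resolve_left
    (mul_ne_zero hq.ne' (by linarith [h2.2]))
  rw [eq_div_iff (by positivity)]
  linear_combination e2
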